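/- Under Assumption (A), for every s ∈ (0,1] there is a constant C depending only on L, M, m, s such that sup over f with ‖f‖_{C^s} ≤ 1 and sup over θ ∈ ℝ^d of ‖f(θ̂) − f(θ)‖_{L_2(P_θ)} is at most C·( (√(d/n))^s ∧ 1 ). -/

import Mathlib

open MeasureTheory Real
open scoped RealInnerProductSpace BigOperators ENNReal NNReal

noncomputable section

abbrev Euc (d : ℕ) : Type := EuclideanSpace ℝ (Fin d)

/-- The noise distribution with density `e^{-V(x)}` w.r.t. Lebesgue measure. -/
def noiseMeasure {d : ℕ} (V : Euc d → ℝ) : Measure (Euc d) :=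
  MeasureTheory.volume.withDensity fun x => ENNReal.ofReal (Real.exp (-(V x)))

/-- The joint distribution of an i.i.d. sample `X_1, …, X_n` from `P_θ(dx) = e^{-V(x-θ)}dx`. -/
def sampleMeasure {d : ℕ} (V : Euc d → ℝ) (n : ℕ) (θ : Euc d) : Measure (Fin n → Euc d) :=
  Measure.pi fun _ => (noiseMeasure V).map (fun x => θ + x)

/-- `ψ_α`-norm of a random variable: `sup_{p ≥ 1} p^{-1/α} (E|η|^p)^{1/p}`. -/
def psiNorm {Ω : Type*} [MeasurableSpace Ω] (α : ℝ) (μ : Measure Ω) (η : Ω → ℝ) : ℝ :=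
  ⨆ p : {p : ℝ // 1 ≤ p}, (p : ℝ) ^ (-(1 / α)) * (∫ ω, |η ω| ^ (p : ℝ) ∂μ) ^ ((1 : ℝ) / (p : ℝ))

/-- `f` belongs to the Hölder ball of radius `B` in `C^s`, `s = l + ρ`. -/
def holderCLe {d : ℕ} (l : ℕ) (ρ : ℝ) (f : Euc d → ℝ) (B : ℝ) : Prop :=
  ContDiff ℝ l f ∧
  (∀ j : ℕ, j ≤ l → ∀ x, ‖iteratedFDeriv ℝ j f x‖ ≤ B) ∧
  (∀ x y, ‖iteratedFDeriv ℝ l f x - iteratedFDeriv ℝ l f y‖ ≤ B * ‖x - y‖ ^ ρ)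

/-- The operator `(T g)(θ) = E_θ g(θ̂)`. -/
def Texp {d : ℕ} (V : Euc d → ℝ) (n : ℕ) (hatθ : (Fin n → Euc d) → Euc d) (g : Euc d → ℝ) :
    Euc d → ℝ :=
  fun θ => ∫ x, g (hatθ x) ∂ sampleMeasure V n θ

/-- The operator `𝓑 = 𝓣 - Id`. -/
def Bop {d : ℕ} (V : Euc d → ℝ) (n : ℕ) (hatθ : (Fin n → Euc d) → Euc d) :
    (Euc d → ℝ) → Euc d → ℝ :=
  fun g θ => Texp V n hatθ g θ - g θ

/-- The bias-corrected functional `f_k = Σ_{j=0}^k (-1)^j 𝓑^j f`. -/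
def biasCorrect {d : ℕ} (V : Euc d → ℝ) (n : ℕ) (hatθ : (Fin n → Euc d) → Euc d) (k : ℕ)
    (f : Euc d → ℝ) : Euc d → ℝ :=
  fun θ => ∑ j ∈ Finset.range (k + 1), (-1 : ℝ) ^ j * (Bop V n hatθ)^[j] f θ

/-- The Poincaré constant `c(V)` of the distribution `e^{-V(x)}dx`. -/
def poincareConst {d : ℕ} (V : Euc d → ℝ) : ℝ :=
  sInf {C : ℝ | 0 ≤ C ∧ ∀ g : Euc d → ℝ, LocallyLipschitz g →
    ∫ x, (g x - ∫ y, g y ∂ noiseMeasure V) ^ 2 ∂ noiseMeasure V ≤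
      C * ∫ x, ‖gradient g x‖ ^ 2 ∂ noiseMeasure V}

theorem add_fderiv_add_half_le_of_le_fderiv_fderiv {E : Type*} [NormedAddCommGroup E]
    [NormedSpace ℝ E] {V : E → ℝ} (hV : ContDiff ℝ 2 V) (x k : E) (c : ℝ)
    (hc : ∀ t ∈ Set.Icc (0 : ℝ) 1, c ≤ fderiv ℝ (fderiv ℝ V) (x + t • k) k k) :
    V x + fderiv ℝ V x k + c / 2 ≤ V (x + k) := by
  have hline (t : ℝ) : HasDerivAt (fun t : ℝ => x + t • k) k t := by
    simpa using ((hasDerivAt_id t).smul_const k).const_add x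
  have hV1 (y : E) : HasFDerivAt V (fderiv ℝ V y) y :=
    ((hV.differentiable (by norm_num)) y).hasFDerivAt
  have hV2 (y : E) : HasFDerivAt (fderiv ℝ V) (fderiv ℝ (fderiv ℝ V) y) y :=
    (((hV.fderiv_right (m := 1) (by norm_num)).differentiable (by norm_num)) y).hasFDerivAt
  have hp (t : ℝ) : HasDerivAt (fun t : ℝ => fderiv ℝ V (x + t • k) k - fderiv ℝ V x k - t * c)
      (fderiv ℝ (fderiv ℝ V) (x + t • k) k k - c) t := by
    have h0 : HasDerivAt (fun t : ℝ => fderiv ℝ V (x + t • k))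
        (fderiv ℝ (fderiv ℝ V) (x + t • k) k) t :=
      (hV2 (x + t • k)).comp_hasDerivAt t (hline t)
    have h1 : HasDerivAt (fun t : ℝ => fderiv ℝ V (x + t • k) k)
        (fderiv ℝ (fderiv ℝ V) (x + t • k) k k) t :=
      (ContinuousLinearMap.apply ℝ ℝ k).hasFDerivAt.comp_hasDerivAt t h0
    have h2 := (h1.sub_const (fderiv ℝ V x k)).sub ((hasDerivAt_id t).mul_const c)
    rw [one_mul] at h2
    exact h2
  have hq (t : ℝ) : HasDerivAt
      (fun t : ℝ => V (x + t • k) - t * fderiv ℝ V x k - t ^ 2 * (c / 2))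
      (fderiv ℝ V (x + t • k) k - fderiv ℝ V x k - t * c) t := by
    have h1 : HasDerivAt (fun t : ℝ => V (x + t • k)) (fderiv ℝ V (x + t • k) k) t :=
      (hV1 (x + t • k)).comp_hasDerivAt t (hline t)
    have h2 := (h1.sub ((hasDerivAt_id t).mul_const (fderiv ℝ V x k))).sub
      ((hasDerivAt_pow 2 t).mul_const (c / 2))
    refine h2.congr_deriv ?_
    simp only [one_mul, Nat.cast_ofNat]
    ring
  have hpmono : MonotoneOn (fun t : ℝ => fderiv ℝ V (x + t • k) k - fderiv ℝ V x k - t * c)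
      (Set.Icc 0 1) := by
    refine monotoneOn_of_deriv_nonneg (convex_Icc 0 1)
      (fun t _ => (hp t).continuousAt.continuousWithinAt)
      (fun t _ => (hp t).differentiableAt.differentiableWithinAt) fun t ht => ?_
    rw [(hp t).deriv]
    linarith [hc t (interior_subset ht)]
  have hqmono : MonotoneOn (fun t : ℝ => V (x + t • k) - t * fderiv ℝ V x k - t ^ 2 * (c / 2))
      (Set.Icc 0 1) := by
    refine monotoneOn_of_deriv_nonneg (convex_Icc 0 1)
      (fun t _ => (hq t).continuousAt.continuousWithinAt)
      (fun t _ => (hq t).differentiableAt.differentiableWithinAt) fun t ht => ?_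
    rw [(hq t).deriv]
    have ht' : t ∈ Set.Icc (0 : ℝ) 1 := interior_subset ht
    simpa using hpmono (Set.left_mem_Icc.2 zero_le_one) ht' ht'.1
  have := hqmono (Set.left_mem_Icc.2 zero_le_one) (Set.right_mem_Icc.2 zero_le_one) zero_le_one
  simp only [zero_smul, add_zero, one_smul, one_mul, zero_mul, ne_eq, OfNat.ofNat_ne_zero,
    not_false_eq_true, zero_pow, one_pow, sub_zero] at this
  linarith

theorem integrable_exp_neg_of_integral_eq_one {d : ℕ} {V : Euc d → ℝ}
    (h1 : ∫ x, exp (-(V x)) = 1) : Integrable fun x => exp (-(V x)) :=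
  Integrable.of_integral_ne_zero (by rw [h1]; exact one_ne_zero)

theorem isProbabilityMeasure_noiseMeasure {d : ℕ} {V : Euc d → ℝ}
    (h1 : ∫ x, exp (-(V x)) = 1) : IsProbabilityMeasure (noiseMeasure V) := by
  refine ⟨?_⟩
  rw [noiseMeasure, withDensity_apply _ MeasurableSet.univ, Measure.restrict_univ,
    ← ofReal_integral_eq_lintegral_ofReal (integrable_exp_neg_of_integral_eq_one h1)
    (ae_of_all _ fun x => (exp_pos _).le), h1, ENNReal.ofReal_one]

theorem integral_noiseMeasure {d : ℕ} {V : Euc d → ℝ} (hV : Continuous V) (g : Euc d → ℝ) :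
    ∫ x, g x ∂ noiseMeasure V = ∫ x, g x * exp (-(V x)) := by
  rw [noiseMeasure, integral_withDensity_eq_integral_toReal_smul (by fun_prop)
    (ae_of_all _ fun x => ENNReal.ofReal_lt_top)]
  refine integral_congr_ae (ae_of_all _ fun x => ?_)
  simp only [ENNReal.toReal_ofReal (exp_pos _).le, smul_eq_mul, mul_comm]

theorem integrable_noiseMeasure_iff {d : ℕ} {V : Euc d → ℝ} (hV : Continuous V)
    (g : Euc d → ℝ) :
    Integrable g (noiseMeasure V) ↔ Integrable fun x => g x * exp (-(V x)) := by
  rw [noiseMeasure, integrable_withDensity_iff_integrable_smul' (by fun_prop)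
    (ae_of_all _ fun x => ENNReal.ofReal_lt_top)]
  simp only [ENNReal.toReal_ofReal (exp_pos _).le, smul_eq_mul, mul_comm]

theorem integral_mul_fderiv_noiseMeasure {d : ℕ} {V φ : Euc d → ℝ} (u : Euc d)
    (hV : Differentiable ℝ V) (hφ : Differentiable ℝ φ)
    (hi : Integrable φ (noiseMeasure V))
    (hi' : Integrable (fun x => fderiv ℝ φ x u) (noiseMeasure V))
    (hiV : Integrable (fun x => φ x * fderiv ℝ V x u) (noiseMeasure V)) :
    ∫ x, φ x * fderiv ℝ V x u ∂ noiseMeasure V = ∫ x, fderiv ℝ φ x u ∂ noiseMeasure V := by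
  have hexp (x : Euc d) : fderiv ℝ (fun x => exp (-(V x))) x u =
      -(fderiv ℝ V x u * exp (-(V x))) := by
    have h : HasFDerivAt (fun x => exp (-(V x))) (exp (-(V x)) • -fderiv ℝ V x) x :=
      (hV x).hasFDerivAt.neg.exp
    rw [h.fderiv]
    simp [mul_comm]
  rw [integrable_noiseMeasure_iff hV.continuous] at hi hi' hiV
  have hd : Differentiable ℝ fun x => exp (-(V x)) := hV.neg.exp
  have key := integral_mul_fderiv_eq_neg_fderiv_mul_of_integrable (μ := volume) (f := φ)
    (g := fun x => exp (-(V x))) (v := u) hi'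
    (by
      refine hiV.neg.congr (ae_of_all _ fun x => ?_)
      simp only [hexp, Pi.neg_apply]
      ring)
    hi (fun x _ => hφ x) (fun x _ => hd x)
  rw [integral_noiseMeasure hV.continuous, integral_noiseMeasure hV.continuous,
    ← neg_eq_iff_eq_neg.2 key, ← integral_neg]
  refine integral_congr_ae (ae_of_all _ fun x => ?_)
  simp only [hexp]
  ring

theorem integrable_and_integral_sq_average_sub_le {Ω : Type*} [MeasurableSpace Ω]
    (P : Measure Ω) [IsProbabilityMeasure P] {n : ℕ} (hn : 0 < n) {Y : Ω → ℝ}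
    (hY : MemLp Y 2 P) :
    Integrable (fun x : Fin n → Ω => ((∑ j, Y (x j)) / n - ∫ y, Y y ∂P) ^ 2)
        (Measure.pi fun _ => P) ∧
      ∫ x : Fin n → Ω, ((∑ j, Y (x j)) / n - ∫ y, Y y ∂P) ^ 2 ∂(Measure.pi fun _ => P) ≤
        (∫ y, Y y ^ 2 ∂P) / n := by
  have hn' : (n : ℝ) ≠ 0 := by positivity
  have hYj (j : Fin n) : MemLp (fun x : Fin n → Ω => Y (x j)) 2 (Measure.pi fun _ => P) :=
    hY.comp_measurePreserving (measurePreserving_eval (fun _ : Fin n => P) j)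
  have hsum : MemLp (∑ j, fun x : Fin n → Ω => Y (x j)) 2 (Measure.pi fun _ => P) :=
    memLp_finsetSum' _ fun j _ => hYj j
  have hmean : ∫ x, (∑ j, fun x : Fin n → Ω => Y (x j)) x ∂(Measure.pi fun _ => P) =
      n * ∫ y, Y y ∂P := by
    simp only [Finset.sum_apply]
    rw [integral_finsetSum _ fun j _ => (hYj j).integrable (by norm_num)]
    have (j : Fin n) : ∫ x : Fin n → Ω, Y (x j) ∂(Measure.pi fun _ => P) = ∫ y, Y y ∂P :=
      integral_comp_eval (μ := fun _ : Fin n => P) hY.aestronglyMeasurable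
    simp [this]
  have hvar := ProbabilityTheory.variance_sum_pi (μ := fun _ : Fin n => P)
    (X := fun _ => Y) fun _ => hY
  rw [ProbabilityTheory.variance_eq_integral hsum.aestronglyMeasurable.aemeasurable, hmean] at hvar
  have hle := ProbabilityTheory.variance_le_expectation_sq hY.aestronglyMeasurable
  have hfun : (fun x : Fin n → Ω => ((∑ j, Y (x j)) / n - ∫ y, Y y ∂P) ^ 2) = fun x =>
      ((∑ j, fun x : Fin n → Ω => Y (x j)) x - n * ∫ y, Y y ∂P) ^ 2 * ((n : ℝ) ^ 2)⁻¹ := by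
    ext x
    simp only [Finset.sum_apply]
    field_simp
  rw [hfun]
  refine ⟨((hsum.sub (memLp_const _)).integrable_sq).mul_const _, ?_⟩
  rw [integral_mul_const, hvar]
  simp only [Finset.sum_const, Finset.card_univ, Fintype.card_fin, nsmul_eq_mul]
  calc _ = ProbabilityTheory.variance Y P / n := by field_simp
    _ ≤ _ := by gcongr; exact hle

theorem min_sq_one_le_of_sum_sub_le {E : Type*} [NormedAddCommGroup E] [NormedSpace ℝ E]
    {V : E → ℝ} (hconv : ConvexOn ℝ Set.univ V) (hV : ContDiff ℝ 2 V) {L m α β : ℝ}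
    (hL : 0 < L) (hm : 0 < m) (hα : 0 ≤ α)
    (hlip : ∀ x y u, |fderiv ℝ (fderiv ℝ V) x u u - fderiv ℝ (fderiv ℝ V) y u u| ≤
      L * ‖x - y‖ * ‖u‖ ^ 2)
    {n : ℕ} (hn : 0 < n) (ξ : Fin n → E) (h : E)
    (hmin : ∑ j, V (ξ j - h) ≤ ∑ j, V (ξ j))
    (hscore : ∀ u, (∑ j, fderiv ℝ V (ξ j) u) / n ≤ α * ‖u‖)
    (hhess : ∀ u, (m - β) * ‖u‖ ^ 2 ≤ (∑ j, fderiv ℝ (fderiv ℝ V) (ξ j) u u) / n) :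
    min (‖h‖ ^ 2) 1 ≤
      (1 + (4 * L / m) ^ 2) * (64 / m ^ 2) * α ^ 2 + 4 / m ^ 2 * β ^ 2 := by
  rcases le_or_gt (m / 2) β with hβ | hβ
  · have : 1 ≤ 4 / m ^ 2 * β ^ 2 := by
      rw [div_mul_eq_mul_div, one_le_div (by positivity)]
      nlinarith
    have : 0 ≤ (1 + (4 * L / m) ^ 2) * (64 / m ^ 2) * α ^ 2 := by positivity
    linarith [min_le_right (‖h‖ ^ 2) 1]
  obtain ⟨τ, hτ0, hτ1, hr, hmin1⟩ : ∃ τ : ℝ, 0 ≤ τ ∧ τ ≤ 1 ∧ ‖τ • h‖ ≤ m / (4 * L) ∧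
      min (‖h‖ ^ 2) 1 ≤ (1 + (4 * L / m) ^ 2) * ‖τ • h‖ ^ 2 := by
    have hr : 0 < m / (4 * L) := by positivity
    rcases le_or_gt ‖h‖ (m / (4 * L)) with hh | hh
    · refine ⟨1, zero_le_one, le_rfl, by simpa using hh, ?_⟩
      rw [one_smul]
      nlinarith [min_le_left (‖h‖ ^ 2) 1, mul_nonneg (sq_nonneg (4 * L / m)) (sq_nonneg ‖h‖)]
    · have hh0 : 0 < ‖h‖ := hr.trans hh
      have hnorm : ‖(m / (4 * L) / ‖h‖) • h‖ = m / (4 * L) := by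
        rw [norm_smul, norm_of_nonneg (by positivity), div_mul_cancel₀ _ hh0.ne']
      refine ⟨m / (4 * L) / ‖h‖, by positivity, (div_le_one hh0).2 hh.le, hnorm.le, ?_⟩
      rw [hnorm]
      have : (4 * L / m) ^ 2 * (m / (4 * L)) ^ 2 = 1 := by field_simp
      nlinarith [min_le_right (‖h‖ ^ 2) 1, sq_nonneg (m / (4 * L))]
  set k := τ • h with hk
  have hn' : (0 : ℝ) < n := by exact_mod_cast hn
  have hdecr : ∑ j, V (ξ j + -k) ≤ ∑ j, V (ξ j) := by
    calc ∑ j, V (ξ j + -k) ≤ ∑ j, ((1 - τ) * V (ξ j) + τ * V (ξ j - h)) := by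
          refine Finset.sum_le_sum fun j _ => ?_
          have := hconv.2 (Set.mem_univ (ξ j)) (Set.mem_univ (ξ j - h)) (sub_nonneg.2 hτ1) hτ0
            (by ring)
          simp only [smul_eq_mul] at this
          convert this using 2
          rw [hk]
          module
      _ = (1 - τ) * ∑ j, V (ξ j) + τ * ∑ j, V (ξ j - h) := by
          rw [Finset.sum_add_distrib, Finset.mul_sum, Finset.mul_sum]
      _ ≤ _ := by nlinarith
  have htaylor (j : Fin n) : V (ξ j) - fderiv ℝ V (ξ j) k +
      (fderiv ℝ (fderiv ℝ V) (ξ j) k k - L * ‖k‖ ^ 3) / 2 ≤ V (ξ j + -k) := by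
    have := add_fderiv_add_half_le_of_le_fderiv_fderiv hV (ξ j) (-k)
      (fderiv ℝ (fderiv ℝ V) (ξ j) k k - L * ‖k‖ ^ 3) fun t ht => by
        have h1 := (abs_le.1 (hlip (ξ j + t • -k) (ξ j) k)).1
        have h2 : ‖ξ j + t • -k - ξ j‖ ≤ ‖k‖ := by
          rw [add_sub_cancel_left, norm_smul, norm_neg, norm_of_nonneg ht.1]
          exact mul_le_of_le_one_left (norm_nonneg _) ht.2
        have h3 : L * ‖ξ j + t • -k - ξ j‖ * ‖k‖ ^ 2 ≤ L * ‖k‖ * ‖k‖ ^ 2 := by gcongr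
        simp only [map_neg, _root_.neg_apply, neg_neg]
        simp only [smul_neg] at h1 h3 ⊢
        linarith
    rw [map_neg] at this
    linarith
  have hsum := (Finset.sum_le_sum fun j (_ : j ∈ Finset.univ) => htaylor j).trans hdecr
  rw [Finset.sum_add_distrib, Finset.sum_sub_distrib, ← Finset.sum_div, Finset.sum_sub_distrib,
    Finset.sum_const, Finset.card_univ, Fintype.card_fin, nsmul_eq_mul] at hsum
  have h1 := hscore k
  have h2 := hhess k
  rw [div_le_iff₀ hn'] at h1
  rw [le_div_iff₀ hn'] at h2
  have h3 : (m - β) * ‖k‖ ^ 2 - L * ‖k‖ ^ 3 ≤ 2 * (α * ‖k‖) := by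
    refine le_of_mul_le_mul_right ?_ hn'
    linarith
  have h4 : L * ‖k‖ ≤ m / 4 := by
    rw [le_div_iff₀ (by positivity)] at hr
    linarith
  have h5 : m / 8 * ‖k‖ ≤ α := by
    rcases (norm_nonneg k).eq_or_lt with h0 | h0
    · rw [← h0, mul_zero]; exact hα
    · refine le_of_mul_le_mul_right ?_ h0
      nlinarith [mul_le_mul_of_nonneg_right h4 (sq_nonneg ‖k‖), mul_pos h0 h0]
  have h6 : ‖k‖ ^ 2 ≤ 64 / m ^ 2 * α ^ 2 := by
    have := pow_le_pow_left₀ (by positivity) h5 2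
    rw [div_mul_eq_mul_div, le_div_iff₀ (by positivity)]
    linarith
  have h7 : (1 + (4 * L / m) ^ 2) * ‖k‖ ^ 2 ≤
      (1 + (4 * L / m) ^ 2) * (64 / m ^ 2 * α ^ 2) := by gcongr
  have h8 : 0 ≤ 4 / m ^ 2 * β ^ 2 := by positivity
  linarith

theorem clm_apply_eq_sum_single {d : ℕ} (ℓ : Euc d →L[ℝ] ℝ) (u : Euc d) :
    ℓ u = ∑ i, u i * ℓ (EuclideanSpace.single i 1) := by
  conv_lhs => rw [← (EuclideanSpace.basisFun (Fin d) ℝ).sum_repr u, map_sum]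
  simp

theorem sum_sq_clm_single_le {d : ℕ} (ℓ : Euc d →L[ℝ] ℝ) :
    ∑ i, ℓ (EuclideanSpace.single i 1) ^ 2 ≤ ‖ℓ‖ ^ 2 := by
  set u : Euc d := WithLp.toLp 2 fun i => ℓ (EuclideanSpace.single i 1) with hu
  have h1 : ℓ u = ∑ i, ℓ (EuclideanSpace.single i 1) ^ 2 := by
    rw [clm_apply_eq_sum_single]
    simp [hu, sq]
  have h2 : ‖u‖ ^ 2 = ∑ i, ℓ (EuclideanSpace.single i 1) ^ 2 := by
    rw [EuclideanSpace.real_norm_sq_eq]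
  have h3 := (le_abs_self _).trans (ℓ.le_opNorm u)
  rw [← h2] at h1 ⊢
  rw [h1] at h3
  nlinarith [norm_nonneg u, norm_nonneg ℓ, sq_nonneg (‖ℓ‖ - ‖u‖)]

theorem sum_mul_le_sqrt_mul_norm {d : ℕ} (a : Fin d → ℝ) (u : Euc d) :
    ∑ i, u i * a i ≤ √(∑ i, a i ^ 2) * ‖u‖ := by
  rw [EuclideanSpace.norm_eq, mul_comm]
  simp only [norm_eq_abs, sq_abs]
  exact Real.sum_mul_le_sqrt_mul_sqrt _ _ _

theorem abs_sum_sum_mul_le_sqrt_mul_norm_sq {d : ℕ} (D : Fin d → Fin d → ℝ) (u : Euc d) :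
    |∑ i, u i * ∑ k, u k * D i k| ≤ √(∑ i, ∑ k, D i k ^ 2) * ‖u‖ ^ 2 := by
  have h1 : ∑ i, u i * ∑ k, u k * D i k = ∑ p : Fin d × Fin d, (u p.1 * u p.2) * D p.1 p.2 := by
    rw [Fintype.sum_prod_type]
    simp only [Finset.mul_sum, mul_assoc]
  have h2 : (‖u‖ ^ 2) ^ 2 = ∑ p : Fin d × Fin d, (u p.1 * u p.2) ^ 2 := by
    rw [EuclideanSpace.real_norm_sq_eq, sq, Finset.sum_mul_sum, Fintype.sum_prod_type]
    simp only [mul_pow]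
  have h3 : ∑ i, ∑ k, D i k ^ 2 = ∑ p : Fin d × Fin d, D p.1 p.2 ^ 2 := by
    rw [Fintype.sum_prod_type]
  have h4 := Finset.sum_mul_sq_le_sq_mul_sq Finset.univ
    (fun p : Fin d × Fin d => u p.1 * u p.2) (fun p => D p.1 p.2)
  refine abs_le_of_sq_le_sq ?_ (by positivity)
  rw [mul_pow, Real.sq_sqrt (by positivity), h1, h2, h3, mul_comm (∑ p : Fin d × Fin d, _)]
  exact h4

theorem integrable_and_integral_sq_sampleMeasure_le {d n : ℕ} (hn : 0 < n) {V : Euc d → ℝ}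
    (h1 : ∫ x, exp (-(V x)) = 1) (θ : Euc d) {w : Euc d → ℝ} (hw : MemLp w 2 (noiseMeasure V)) :
    Integrable (fun x : Fin n → Euc d => ((∑ j, w (x j - θ)) / n - ∫ y, w y ∂noiseMeasure V) ^ 2)
        (sampleMeasure V n θ) ∧
      ∫ x, ((∑ j, w (x j - θ)) / n - ∫ y, w y ∂noiseMeasure V) ^ 2 ∂sampleMeasure V n θ ≤
        (∫ y, w y ^ 2 ∂noiseMeasure V) / n := by
  have := isProbabilityMeasure_noiseMeasure h1
  have hemb : MeasurableEmbedding fun x : Euc d => θ + x := measurableEmbedding_addLeft θ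
  have : IsProbabilityMeasure ((noiseMeasure V).map fun x => θ + x) :=
    Measure.isProbabilityMeasure_map hemb.measurable.aemeasurable
  have hY : MemLp (fun x => w (x - θ)) 2 ((noiseMeasure V).map fun x => θ + x) := by
    rw [hemb.memLp_map_measure_iff]
    simpa [Function.comp_def] using hw
  have h := integrable_and_integral_sq_average_sub_le _ hn hY
  rw [hemb.integral_map, hemb.integral_map] at h
  simp only [add_sub_cancel_left] at h
  exact h

theorem memLp_and_le_integral_of_fisher {d : ℕ} {V : Euc d → ℝ} {J : Euc d →L[ℝ] Euc d} {M m : ℝ}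
    (hm : 0 < m) (hV : ContDiff ℝ 2 V) (h1 : ∫ x, exp (-(V x)) = 1)
    (hM : ∀ x u v, |fderiv ℝ (fderiv ℝ V) x u v| ≤ M * ‖u‖ * ‖v‖)
    (hJ : ∀ u, J u = ∫ x, ⟪gradient V x, u⟫ • gradient V x ∂ noiseMeasure V)
    (hJm : ∀ u : Euc d, m * ‖u‖ ^ 2 ≤ ⟪J u, u⟫) (u : Euc d) :
    MemLp (fun x => fderiv ℝ V x u) 2 (noiseMeasure V) ∧
      ∫ x, fderiv ℝ V x u ∂noiseMeasure V = 0 ∧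
      ∫ x, fderiv ℝ V x u ^ 2 ∂noiseMeasure V =
        ∫ x, fderiv ℝ (fderiv ℝ V) x u u ∂noiseMeasure V ∧
      m * ‖u‖ ^ 2 ≤ ∫ x, fderiv ℝ (fderiv ℝ V) x u u ∂noiseMeasure V := by
  rcases eq_or_ne u 0 with rfl | hu
  · simp
  have := isProbabilityMeasure_noiseMeasure h1
  have hdV : Differentiable ℝ V := hV.differentiable (by norm_num)
  have hV1 : ContDiff ℝ 1 (fderiv ℝ V) := hV.fderiv_right (by norm_num)
  have hdV1 : Differentiable ℝ (fderiv ℝ V) := hV1.differentiable (by norm_num)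
  have hcV2 : Continuous (fderiv ℝ (fderiv ℝ V)) := hV1.continuous_fderiv (by norm_num)
  have hcont : Continuous fun x => fderiv ℝ V x u := hV1.continuous.clm_apply continuous_const
  have hint : Integrable (fun x => ⟪gradient V x, u⟫ • gradient V x) (noiseMeasure V) := by
    refine Integrable.of_integral_ne_zero fun h0 => ?_
    have h2 := hJm u
    rw [hJ u, h0, inner_zero_left] at h2
    have : 0 < ‖u‖ := norm_pos_iff.2 hu
    have : 0 < m * ‖u‖ ^ 2 := by positivity
    linarith
  have hsq (x : Euc d) : ⟪u, ⟪gradient V x, u⟫ • gradient V x⟫ = fderiv ℝ V x u ^ 2 := by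
    rw [inner_smul_right, real_inner_comm (gradient V x) u, inner_gradient_left, sq]
  have hint2 : Integrable (fun x => fderiv ℝ V x u ^ 2) (noiseMeasure V) := by
    have h2 : Integrable (fun x => ⟪u, ⟪gradient V x, u⟫ • gradient V x⟫) (noiseMeasure V) :=
      Integrable.const_inner (𝕜 := ℝ) u hint
    simp only [hsq] at h2
    exact h2
  have hL2 : MemLp (fun x => fderiv ℝ V x u) 2 (noiseMeasure V) :=
    (memLp_two_iff_integrable_sq hcont.aestronglyMeasurable).2 hint2
  have hL1 : Integrable (fun x => fderiv ℝ V x u) (noiseMeasure V) :=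
    hL2.integrable (by norm_num)
  have hJu : ⟪J u, u⟫ = ∫ x, fderiv ℝ V x u ^ 2 ∂noiseMeasure V := by
    rw [real_inner_comm, hJ u, ← integral_inner hint]
    simp only [hsq]
  have hder (x : Euc d) : fderiv ℝ (fun x => fderiv ℝ V x u) x u =
      fderiv ℝ (fderiv ℝ V) x u u := by
    have : HasFDerivAt (fun x => fderiv ℝ V x u)
        ((ContinuousLinearMap.apply ℝ ℝ u).comp (fderiv ℝ (fderiv ℝ V) x)) x :=
      (ContinuousLinearMap.apply ℝ ℝ u).hasFDerivAt.comp x (hdV1 x).hasFDerivAt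
    rw [this.fderiv]
    rfl
  have hzero : ∫ x, fderiv ℝ V x u ∂noiseMeasure V = 0 := by
    have := integral_mul_fderiv_noiseMeasure (φ := fun _ => 1) u hdV (differentiable_const _)
      (integrable_const _) (by simp) (by simpa using hL1)
    simpa using this
  have hfisher : ∫ x, fderiv ℝ V x u ^ 2 ∂noiseMeasure V =
      ∫ x, fderiv ℝ (fderiv ℝ V) x u u ∂noiseMeasure V := by
    have := integral_mul_fderiv_noiseMeasure (φ := fun x => fderiv ℝ V x u) u hdV
      (fun x => (hdV1 x).clm_apply (differentiableAt_const u)) hL1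
      (by
        simp only [hder]
        refine Integrable.of_bound (C := M * ‖u‖ * ‖u‖)
          ((hcV2.clm_apply continuous_const).clm_apply continuous_const).aestronglyMeasurable
          (ae_of_all _ fun x => ?_)
        rw [norm_eq_abs]
        exact hM x u u)
      (by simpa only [← sq] using hint2)
    simpa only [← sq, hder] using this
  exact ⟨hL2, hzero, hfisher, hfisher ▸ hJu ▸ hJm u⟩

theorem exists_integrable_bound_of_minimizer {d n : ℕ} {V : Euc d → ℝ} {J : Euc d →L[ℝ] Euc d}
    {L M m : ℝ} (hL : 0 < L) (hm : 0 < m) (hn : 0 < n)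
    (hconv : ConvexOn ℝ Set.univ V) (hV : ContDiff ℝ 2 V) (h1 : ∫ x, exp (-(V x)) = 1)
    (hM : ∀ x u v, |fderiv ℝ (fderiv ℝ V) x u v| ≤ M * ‖u‖ * ‖v‖)
    (hM' : ∀ x u, ‖fderiv ℝ (fderiv ℝ V) x u‖ ≤ M * ‖u‖)
    (hlip : ∀ x y u, |fderiv ℝ (fderiv ℝ V) x u u - fderiv ℝ (fderiv ℝ V) y u u| ≤
      L * ‖x - y‖ * ‖u‖ ^ 2)
    (hJ : ∀ u, J u = ∫ x, ⟪gradient V x, u⟫ • gradient V x ∂ noiseMeasure V)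
    (hJm : ∀ u : Euc d, m * ‖u‖ ^ 2 ≤ ⟪J u, u⟫)
    {hatθ : (Fin n → Euc d) → Euc d}
    (hmin : ∀ (x : Fin n → Euc d) (θ' : Euc d), ∑ j, V (x j - hatθ x) ≤ ∑ j, V (x j - θ'))
    (θ : Euc d) :
    ∃ G : (Fin n → Euc d) → ℝ, Integrable G (sampleMeasure V n θ) ∧
      ∫ x, G x ∂sampleMeasure V n θ ≤
        ((1 + (4 * L / m) ^ 2) * (64 / m ^ 2) * M + 4 / m ^ 2 * M ^ 2) * (d / n) ∧
      ∀ x, min (‖hatθ x - θ‖ ^ 2) 1 ≤ G x := by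
  have := isProbabilityMeasure_noiseMeasure h1
  set μ := noiseMeasure V
  set e : Fin d → Euc d := fun i => EuclideanSpace.single i 1 with he
  have henorm (i : Fin d) : ‖e i‖ = 1 := by simp [he]
  have hV1 : ContDiff ℝ 1 (fderiv ℝ V) := hV.fderiv_right (by norm_num)
  have hcV2 : Continuous (fderiv ℝ (fderiv ℝ V)) := hV1.continuous_fderiv (by norm_num)
  have hfish := memLp_and_le_integral_of_fisher hm hV h1 hM hJ hJm
  have hscore (i : Fin d) := integrable_and_integral_sq_sampleMeasure_le hn h1 θ (hfish (e i)).1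
  have hHL2 (u v : Euc d) : MemLp (fun x => fderiv ℝ (fderiv ℝ V) x u v) 2 μ := by
    refine MemLp.of_bound
      ((hcV2.clm_apply continuous_const).clm_apply continuous_const).aestronglyMeasurable
      (M * ‖u‖ * ‖v‖) (ae_of_all _ fun x => ?_)
    rw [norm_eq_abs]
    exact hM x u v
  have hHint (u v : Euc d) : Integrable (fun x => fderiv ℝ (fderiv ℝ V) x u v) μ :=
    (hHL2 u v).integrable (by norm_num)
  have hhess (i k : Fin d) := integrable_and_integral_sq_sampleMeasure_le hn h1 θ (hHL2 (e i) (e k))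
  simp only [(hfish _).2.1, sub_zero] at hscore
  set A : (Fin n → Euc d) → ℝ := fun x => ∑ i, ((∑ j, fderiv ℝ V (x j - θ) (e i)) / n) ^ 2
  set B : (Fin n → Euc d) → ℝ := fun x => ∑ i, ∑ k,
    ((∑ j, fderiv ℝ (fderiv ℝ V) (x j - θ) (e i) (e k)) / n -
      ∫ y, fderiv ℝ (fderiv ℝ V) y (e i) (e k) ∂μ) ^ 2 with hB
  have hAi : Integrable A (sampleMeasure V n θ) := integrable_finsetSum _ fun i _ => (hscore i).1
  have hBi : Integrable B (sampleMeasure V n θ) :=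
    integrable_finsetSum _ fun i _ => integrable_finsetSum _ fun k _ => (hhess i k).1
  have hAle : ∫ x, A x ∂sampleMeasure V n θ ≤ M * (d / n) := by
    rw [integral_finsetSum _ fun i _ => (hscore i).1]
    calc _ ≤ ∑ i : Fin d, M / n := by
          refine Finset.sum_le_sum fun i _ => (hscore i).2.trans ?_
          rw [(hfish (e i)).2.2.1]
          gcongr
          calc _ ≤ ∫ _, M ∂μ := integral_mono (hHint _ _) (integrable_const _) fun x => by
                simpa [henorm] using (le_abs_self _).trans (hM x (e i) (e i))
            _ = M := by simp
      _ = _ := by simp; ring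
  have hBle : ∫ x, B x ∂sampleMeasure V n θ ≤ M ^ 2 * (d / n) := by
    rw [integral_finsetSum _ fun i _ => integrable_finsetSum _ fun k _ => (hhess i k).1]
    calc _ ≤ ∑ i : Fin d, M ^ 2 / n := by
          refine Finset.sum_le_sum fun i _ => ?_
          rw [integral_finsetSum _ fun k _ => (hhess i k).1]
          refine (Finset.sum_le_sum fun k _ => (hhess i k).2).trans ?_
          rw [← Finset.sum_div, ← integral_finsetSum _ fun k _ => (hHL2 (e i) (e k)).integrable_sq]
          gcongr
          calc _ ≤ ∫ _, M ^ 2 ∂μ :=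
                integral_mono (integrable_finsetSum _ fun k _ => (hHL2 (e i) (e k)).integrable_sq)
                  (integrable_const _) fun x =>
                  (sum_sq_clm_single_le (fderiv ℝ (fderiv ℝ V) x (e i))).trans
                    (pow_le_pow_left₀ (norm_nonneg _)
                      (by simpa [henorm] using hM' x (e i)) 2)
            _ = M ^ 2 := by simp
      _ = _ := by simp; ring
  refine ⟨fun x => (1 + (4 * L / m) ^ 2) * (64 / m ^ 2) * A x + 4 / m ^ 2 * B x,
    (hAi.const_mul _).add (hBi.const_mul _), ?_, fun x => ?_⟩
  · rw [integral_add (hAi.const_mul _) (hBi.const_mul _), integral_const_mul, integral_const_mul]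
    have h2 := mul_le_mul_of_nonneg_left hAle
      (by positivity : 0 ≤ (1 + (4 * L / m) ^ 2) * (64 / m ^ 2))
    have h3 := mul_le_mul_of_nonneg_left hBle (by positivity : 0 ≤ 4 / m ^ 2)
    linarith
  · have hA0 : 0 ≤ A x := by positivity
    have hB0 : 0 ≤ B x := by positivity
    have key := min_sq_one_le_of_sum_sub_le (α := √(A x)) (β := √(B x)) hconv hV hL hm
      (sqrt_nonneg _) hlip hn (fun j => x j - θ) (hatθ x - θ)
      (by simpa only [sub_sub_sub_cancel_right] using hmin x θ)
      (fun u => by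
        refine le_trans (le_of_eq ?_) (sum_mul_le_sqrt_mul_norm _ u)
        simp only [fun j => clm_apply_eq_sum_single (fderiv ℝ V (x j - θ)) u]
        rw [Finset.sum_comm, Finset.sum_div]
        refine Finset.sum_congr rfl fun i _ => ?_
        rw [← Finset.mul_sum, mul_div_assoc])
      (fun u => by
        have hexp (H : Euc d →L[ℝ] Euc d →L[ℝ] ℝ) :
            H u u = ∑ i, u i * ∑ k, u k * H (e i) (e k) := by
          have h2 := clm_apply_eq_sum_single (H.flip u) u
          simp only [ContinuousLinearMap.flip_apply] at h2
          rw [h2]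
          exact Finset.sum_congr rfl fun i _ => by rw [clm_apply_eq_sum_single (H _) u]
        have hK := (hfish u).2.2.2
        have hKe : ∫ y, fderiv ℝ (fderiv ℝ V) y u u ∂μ =
            ∑ i, u i * ∑ k, u k * ∫ y, fderiv ℝ (fderiv ℝ V) y (e i) (e k) ∂μ := by
          simp only [hexp]
          rw [integral_finsetSum _ fun i _ =>
            (integrable_finsetSum _ fun k _ => (hHint _ _).const_mul _).const_mul _]
          refine Finset.sum_congr rfl fun i _ => ?_
          rw [integral_const_mul, integral_finsetSum _ fun k _ => (hHint _ _).const_mul _]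
          simp only [integral_const_mul]
        have hSe : (∑ j, fderiv ℝ (fderiv ℝ V) (x j - θ) u u) / n =
            ∑ i, u i * ∑ k, u k *
              ((∑ j, fderiv ℝ (fderiv ℝ V) (x j - θ) (e i) (e k)) / n) := by
          simp only [hexp]
          rw [Finset.sum_comm, Finset.sum_div]
          refine Finset.sum_congr rfl fun i _ => ?_
          rw [← Finset.mul_sum, mul_div_assoc, Finset.sum_comm, Finset.sum_div]
          congr 1
          refine Finset.sum_congr rfl fun k _ => ?_
          rw [← Finset.mul_sum, mul_div_assoc]
        have hD := (abs_le.1 (abs_sum_sum_mul_le_sqrt_mul_norm_sq (fun i k =>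
          (∑ j, fderiv ℝ (fderiv ℝ V) (x j - θ) (e i) (e k)) / n -
            ∫ y, fderiv ℝ (fderiv ℝ V) y (e i) (e k) ∂μ) u)).1
        simp only [mul_sub, Finset.sum_sub_distrib] at hD
        rw [hKe] at hK
        rw [hSe]
        simp only [hB]
        linarith)
    rwa [sq_sqrt hA0, sq_sqrt hB0] at key

theorem rpow_le_rpow_mul_one_add_div {y ε s : ℝ} (hy : 0 ≤ y) (hε : 0 < ε) (hs : 0 < s)
    (hs1 : s ≤ 1) : y ^ s ≤ ε ^ s * (1 + y / ε) := by
  have h : (y / ε) ^ s ≤ 1 + y / ε := by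
    have h0 : 0 ≤ y / ε := by positivity
    rcases le_total (y / ε) 1 with h | h
    · exact (rpow_le_one h0 h hs.le).trans (by linarith)
    · exact (rpow_le_rpow_of_exponent_le h hs1).trans (by rw [rpow_one]; linarith)
  calc y ^ s = ε ^ s * (y / ε) ^ s := by
        rw [← mul_rpow hε.le (by positivity), mul_div_cancel₀ _ hε.ne']
    _ ≤ _ := by gcongr

theorem holderCLe_zero_sub_sq_le {d : ℕ} {s : ℝ} {f : Euc d → ℝ}
    (hf : holderCLe 0 s f 1) (x y : Euc d) :
    (f x - f y) ^ 2 ≤ 4 * min (‖x - y‖ ^ 2) 1 ^ s := by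
  obtain ⟨-, hb, hh⟩ := hf
  have hb' (z : Euc d) : |f z| ≤ 1 := by
    simpa using hb 0 le_rfl z
  rcases le_total ‖x - y‖ 1 with h | h
  · have h1 : |f x - f y| ≤ ‖x - y‖ ^ s := by
      have h2 := (iteratedFDeriv ℝ 0 f x - iteratedFDeriv ℝ 0 f y).le_opNorm Fin.elim0
      have h3 := hh x y
      simp only [_root_.sub_apply, iteratedFDeriv_zero_apply, norm_eq_abs,
        Finset.univ_eq_empty, Finset.prod_empty, mul_one] at h2
      linarith
    rw [min_eq_left (by nlinarith [norm_nonneg (x - y)]), ← sq_abs]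
    calc |f x - f y| ^ 2 ≤ (‖x - y‖ ^ s) ^ 2 := by gcongr
      _ = (‖x - y‖ ^ 2) ^ s := by
        rw [← rpow_natCast, ← rpow_natCast, ← rpow_mul (norm_nonneg _),
          ← rpow_mul (norm_nonneg _), mul_comm]
      _ ≤ _ := by linarith [rpow_nonneg (sq_nonneg ‖x - y‖) s]
  · rw [min_eq_right (by nlinarith), one_rpow]
    have h1 := abs_le.1 (hb' x)
    have h2 := abs_le.1 (hb' y)
    nlinarith

/-- Proposition 2.4, part 1: risk bound for the plug-in estimator `f(θ̂)`
over the unit ball of `C^s`, `s ∈ (0,1]`. -/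
theorem stmt_2 :
    ∀ (L M m s : ℝ),
      0 < L → 0 < M → 0 < m → 0 < s → s ≤ 1 →
      ∃ C : ℝ, 0 < C ∧
        ∀ (d n : ℕ) (V : Euc d → ℝ) (J : Euc d →L[ℝ] Euc d)
          (hatθ : (Fin n → Euc d) → Euc d),
          0 < n →
          StrictConvexOn ℝ Set.univ V →
          ContDiff ℝ 2 V →
          (∫ x, Real.exp (-(V x)) = 1) →
          (∀ x, ‖iteratedFDeriv ℝ 2 V x‖ ≤ M) →
          (∀ x y, ‖iteratedFDeriv ℝ 2 V x - iteratedFDeriv ℝ 2 V y‖ ≤ L * ‖x - y‖) →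
          (∀ u, J u = ∫ x, ⟪gradient V x, u⟫ • gradient V x ∂ noiseMeasure V) →
          (∀ u : Euc d, m * ‖u‖ ^ 2 ≤ ⟪J u, u⟫) →
          (∀ (x : Fin n → Euc d) (θ' : Euc d),
            ∑ j, V (x j - hatθ x) ≤ ∑ j, V (x j - θ')) →
          ∀ f : Euc d → ℝ, holderCLe 0 s f 1 →
            ∀ θ : Euc d,
              Real.sqrt (∫ x, (f (hatθ x) - f θ) ^ 2 ∂ sampleMeasure V n θ) ≤
                C * min (Real.sqrt ((d : ℝ) / n) ^ s) 1 := by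
  intro L M m s hL hM0 hm hs hs1
  set C₁ : ℝ := (1 + (4 * L / m) ^ 2) * (64 / m ^ 2) * M + 4 / m ^ 2 * M ^ 2
  have hC₁0 : 0 ≤ C₁ := by positivity
  refine ⟨2 * √(1 + C₁), by positivity, ?_⟩
  intro d n V J hatθ hn hconv hV h1 hM hlip hJ hJm hmin f hf θ
  have hn' : (0 : ℝ) < n := by exact_mod_cast hn
  have hsqrt : 1 ≤ √(1 + C₁) := one_le_sqrt.2 (by linarith)
  have hprob := isProbabilityMeasure_noiseMeasure h1
  have : IsProbabilityMeasure ((noiseMeasure V).map fun x => θ + x) :=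
    Measure.isProbabilityMeasure_map (measurable_const_add θ).aemeasurable
  have : IsProbabilityMeasure (sampleMeasure V n θ) := by
    unfold sampleMeasure
    infer_instance
  have hfle (x : Fin n → Euc d) := holderCLe_zero_sub_sq_le hf (hatθ x) θ
  rcases Nat.eq_zero_or_pos d with rfl | hd
  · have (x : Fin n → Euc 0) : hatθ x = θ := Subsingleton.elim _ _
    simp only [this, sub_self]
    simp only [ne_eq, OfNat.ofNat_ne_zero, not_false_eq_true, zero_pow, integral_zero, sqrt_zero]
    positivity
  have hε : (0 : ℝ) < d / n := by positivity
  have hpow : √((d : ℝ) / n) ^ s = √(((d : ℝ) / n) ^ s) := by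
    rw [sqrt_eq_rpow, sqrt_eq_rpow, ← rpow_mul hε.le, ← rpow_mul hε.le, mul_comm]
  rw [mul_min_of_nonneg _ _ (by positivity), le_min_iff]
  constructor
  · have hM2 (x u v : Euc d) : |fderiv ℝ (fderiv ℝ V) x u v| ≤ M * ‖u‖ * ‖v‖ := by
      have h2 := (iteratedFDeriv ℝ 2 V x).le_of_opNorm_le (hM x) ![u, v]
      simpa [iteratedFDeriv_two_apply, Fin.prod_univ_two, mul_assoc] using h2
    have hlip2 (x y u : Euc d) :
        |fderiv ℝ (fderiv ℝ V) x u u - fderiv ℝ (fderiv ℝ V) y u u| ≤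
          L * ‖x - y‖ * ‖u‖ ^ 2 := by
      have h2 := (iteratedFDeriv ℝ 2 V x - iteratedFDeriv ℝ 2 V y).le_of_opNorm_le
        (hlip x y) ![u, u]
      simpa [iteratedFDeriv_two_apply, Fin.prod_univ_two, sq] using h2
    obtain ⟨G, hGi, hGle, hG⟩ := exists_integrable_bound_of_minimizer hL hm hn hconv.convexOn hV h1
      hM2 (fun x u => ContinuousLinearMap.opNorm_le_bound _ (by positivity) fun v => hM2 x u v)
      hlip2 hJ hJm hmin θ
    rw [hpow, mul_assoc, ← sqrt_mul (by positivity), ← sqrt_sq (zero_le_two (α := ℝ)),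
      ← sqrt_mul (by positivity)]
    refine sqrt_le_sqrt ?_
    have hint : Integrable (fun x => 4 * ((d / n : ℝ) ^ s * (1 + G x / (d / n))))
        (sampleMeasure V n θ) :=
      (((integrable_const _).add (hGi.div_const _)).const_mul _).const_mul _
    calc _ ≤ ∫ x, 4 * ((d / n : ℝ) ^ s * (1 + G x / (d / n))) ∂sampleMeasure V n θ := by
          refine integral_mono_of_nonneg (ae_of_all _ fun x => sq_nonneg _) hint
            (ae_of_all _ fun x => (hfle x).trans ?_)
          have h0 : 0 ≤ min (‖hatθ x - θ‖ ^ 2) 1 := by positivity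
          have h2 := rpow_le_rpow_mul_one_add_div (h0.trans (hG x)) hε hs hs1
          have h3 := rpow_le_rpow h0 (hG x) hs.le
          linarith
      _ = 4 * ((d / n : ℝ) ^ s * (1 + (∫ x, G x ∂sampleMeasure V n θ) / (d / n))) := by
          rw [integral_const_mul, integral_const_mul,
            integral_add (integrable_const _) (hGi.div_const _), integral_div]
          simp
      _ ≤ 4 * ((d / n : ℝ) ^ s * (1 + C₁)) := by
          have : (∫ x, G x ∂sampleMeasure V n θ) / (d / n) ≤ C₁ := (div_le_iff₀ hε).2 hGle
          gcongr
      _ = _ := by ring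
  · rw [mul_one]
    calc _ ≤ √(2 ^ 2) := by
          refine sqrt_le_sqrt ?_
          calc _ ≤ ∫ _, (2 : ℝ) ^ 2 ∂sampleMeasure V n θ := by
                refine integral_mono_of_nonneg (ae_of_all _ fun x => sq_nonneg _)
                  (integrable_const _) (ae_of_all _ fun x => (hfle x).trans ?_)
                have := rpow_le_one (z := s) (by positivity : 0 ≤ min (‖hatθ x - θ‖ ^ 2) 1)
                  (min_le_right _ _) hs.le
                linarith
            _ = _ := by simp
      _ = 2 := sqrt_sq zero_le_two
      _ ≤ _ := by linarith
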